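/- Let P_{m,k} be a generalized Petersen graph (m ≥ 3, k ≥ 1) of order 2m and T a tree of order n; let d_p = diam(P_{m,k}), d_t = diam(T), ε = ε(T). If rn(P_{m,k} □ T) = (2mn − 1)(d_t + ε) − 4m·L(T), then there exists an ordering z_0, z_1, …, z_{2mn−1} of the vertices of P_{m,k} □ T, with z_t = (x_{i_t}, y_{j_t}), such that for all 0 ≤ t ≤ 2mn − 2: (a) d_{P_{m,k}}(x_{i_t}, x_{i_{t+1}}) = d_p; (b) L_T(y_{j_0}) + L_T(y_{j_{2mn−1}}) = 0; (c) y_{j_t} and y_{j_{t+1}} are in different branches of T when |W(T)| = 1 and in opposite branches when |W(T)| = 2; and (d) the mapping f defined on the ordering by f(z_0) = 0 and f(z_{t+1}) = f(z_t) + d_t + ε − L_T(y_{j_t}) − L_T(y_{j_{t+1}}) is a radio labeling of P_{m,k} □ T. -/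

import Mathlib

/-!
Common definitions: radio labelings, weight centers, levels, branches,
generalized Petersen graphs, stars.
-/

open Finset

namespace RadioPaper

variable {V : Type*}

/-- The diameter of a finite graph: the maximum distance between two vertices. -/
noncomputable def graphDiam [Fintype V] (G : SimpleGraph V) : ℕ :=
  Finset.univ.sup fun p : V × V => G.dist p.1 p.2

/-- A radio labeling of `G`: `|f u - f v| ≥ diam G + 1 - d(u,v)` for distinct `u, v`. -/
def IsRadioLabeling [Fintype V] (G : SimpleGraph V) (f : V → ℕ) : Prop :=
  ∀ u v : V, u ≠ v → (graphDiam G : ℤ) + 1 - G.dist u v ≤ |(f u : ℤ) - (f v : ℤ)|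

/-- The span of a labeling: the maximum of `|f u - f v|` over all pairs of vertices. -/
noncomputable def radioSpan [Fintype V] (f : V → ℕ) : ℕ :=
  Finset.univ.sup fun p : V × V => f p.1 - f p.2

/-- The radio number of `G`: the minimum span over all radio labelings. -/
noncomputable def radioNumber [Fintype V] (G : SimpleGraph V) : ℕ :=
  sInf {s : ℕ | ∃ f : V → ℕ, IsRadioLabeling G f ∧ radioSpan f = s}

/-- The weight of a graph at a vertex `u`: the sum of distances from `u` to all vertices. -/
noncomputable def weight [Fintype V] (T : SimpleGraph V) (u : V) : ℕ :=
  ∑ v : V, T.dist u v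

/-- The set of weight centers: vertices minimizing the weight. -/
def weightCenters [Fintype V] (T : SimpleGraph V) : Set V :=
  {c | ∀ u : V, weight T c ≤ weight T u}

/-- The level of a vertex: its distance to a nearest weight center. -/
noncomputable def level [Fintype V] (T : SimpleGraph V) (x : V) : ℕ :=
  sInf {d : ℕ | ∃ w ∈ weightCenters T, T.dist x w = d}

/-- The total level of `T`: sum of the levels of all vertices. -/
noncomputable def totalLevel [Fintype V] (T : SimpleGraph V) : ℕ :=
  ∑ x : V, level T x

/-- `ε(T) = 1` if `T` has a unique weight center, and `0` otherwise (two centers). -/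
noncomputable def eps [Fintype V] (T : SimpleGraph V) : ℕ :=
  if (weightCenters T).ncard = 1 then 1 else 0

/-- `z` is an ancestor of `x` in the tree rooted at its weight center(s):
`z` lies on the path from some weight center to `x`. -/
def IsAncestor [Fintype V] (T : SimpleGraph V) (z x : V) : Prop :=
  ∃ w ∈ weightCenters T, T.dist w z + T.dist z x = T.dist w x

/-- `φ_T(x,y)`: the maximum level of a common ancestor of `x` and `y`. -/
noncomputable def phi [Fintype V] (T : SimpleGraph V) (x y : V) : ℕ :=
  sSup {l : ℕ | ∃ z : V, IsAncestor T z x ∧ IsAncestor T z y ∧ level T z = l}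

/-- `x` and `y` are in opposite branches: `T` has two weight centers `w, w'` and
`x, y` lie in different components of `T - ww'`. -/
def OppositeBranches [Fintype V] (T : SimpleGraph V) (x y : V) : Prop :=
  ∃ w w' : V, w ≠ w' ∧ weightCenters T = {w, w'} ∧
    ¬ (T.deleteEdges {s(w, w')}).Reachable x y

open Classical in
/-- `δ_T(x,y) = 1` if `T` has two weight centers and `x, y` are in opposite branches,
and `0` otherwise. -/
noncomputable def delta [Fintype V] (T : SimpleGraph V) (x y : V) : ℕ :=
  if (weightCenters T).ncard = 2 ∧ OppositeBranches T x y then 1 else 0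

/-- `x` and `y` are in different branches: some weight center lies on the `x`–`y` path
(equivalently, the paths from the center to `x` and to `y` depart through different
neighbours, or one of `x, y` is a weight center). -/
def DifferentBranches [Fintype V] (T : SimpleGraph V) (x y : V) : Prop :=
  ∃ w ∈ weightCenters T, T.dist x w + T.dist w y = T.dist x y

/-- `x` and `y` are in the same branch: both belong to the branch of `T` induced by some
non-central neighbour `u` of a weight center `w` together with all of `u`'s descendants. -/
def SameBranch [Fintype V] (T : SimpleGraph V) (x y : V) : Prop :=
  ∃ w ∈ weightCenters T, ∃ u : V, u ∉ weightCenters T ∧ T.Adj w u ∧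
    T.dist w x = 1 + T.dist u x ∧ T.dist w y = 1 + T.dist u y

/-- The generalized Petersen graph `P_{m,k}`: outer vertices `(false, i)` (the `u_i`) and
inner vertices `(true, i)` (the `v_i`), with edges `u_i u_{i+1}`, `u_i v_i`, `v_i v_{i+k}`. -/
def genPetersen (m k : ℕ) : SimpleGraph (Bool × ZMod m) :=
  SimpleGraph.fromRel fun a b =>
    (a.1 = false ∧ b.1 = false ∧ b.2 = a.2 + 1) ∨
    (a.1 = false ∧ b.1 = true ∧ a.2 = b.2) ∨
    (a.1 = true ∧ b.1 = true ∧ b.2 = a.2 + (k : ZMod m))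

/-- The star `K_{1,n}`: vertex `0` is the centre, joined to the `n` leaves. -/
def starGraph (n : ℕ) : SimpleGraph (Fin (n + 1)) :=
  SimpleGraph.fromRel fun a _ => a = 0


section Distance

open SimpleGraph

/-- In a connected graph, if `x` is strictly closer to `a` than to `c`, a shortest path from
`x` to `a` avoids the edge `ac`. -/
lemma reachable_deleteEdges_of_dist_lt {T : SimpleGraph V} (hT : T.Connected) {a c x : V}
    (h : T.dist x a < T.dist x c) : (T.deleteEdges {s(a, c)}).Reachable x a := by
  classical
  obtain ⟨p, hp⟩ := hT.exists_walk_length_eq_dist x a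
  rw [reachable_deleteEdges_iff_exists_walk]
  refine ⟨p, fun he => ?_⟩
  have hc : c ∈ p.support := p.snd_mem_support_of_mem_edges he
  have h1 := dist_le (p.takeUntil c hc)
  have h2 := p.length_takeUntil_le_length hc
  omega

/-- The two sides of an edge of a tree are separated by removing that edge. -/
lemma not_reachable_deleteEdges_of_dist_lt {T : SimpleGraph V} (hT : T.IsTree) {a c x y : V}
    (hac : T.Adj a c) (hx : T.dist x a < T.dist x c) (hy : T.dist y c < T.dist y a) :
    ¬ (T.deleteEdges {s(a, c)}).Reachable x y := by
  intro hxy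
  have hb := isAcyclic_iff_forall_adj_isBridge.1 hT.isAcyclic hac
  have h1 := reachable_deleteEdges_of_dist_lt hT.connected hx
  have h2 := reachable_deleteEdges_of_dist_lt hT.connected hy
  rw [Sym2.eq_swap] at h2
  exact (isBridge_iff.1 hb) (h1.symm.trans (hxy.trans h2))

/-- In a tree, the distance between vertices on opposite sides of an edge is at least the sum
of their distances to an end of that edge. -/
lemma dist_add_dist_le_of_dist_lt {T : SimpleGraph V} (hT : T.IsTree) {a c x y : V}
    (hac : T.Adj a c) (hx : T.dist x a < T.dist x c) (hy : T.dist y c < T.dist y a) :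
    T.dist x a + T.dist a y ≤ T.dist x y := by
  classical
  obtain ⟨p, hp⟩ := hT.connected.exists_walk_length_eq_dist x y
  have he : s(a, c) ∈ p.edges := by
    by_contra he
    exact not_reachable_deleteEdges_of_dist_lt hT hac hx hy
      (reachable_deleteEdges_iff_exists_walk.2 ⟨p, he⟩)
  have ha : a ∈ p.support := p.fst_mem_support_of_mem_edges he
  have h1 := dist_le (p.takeUntil a ha)
  have h2 := dist_le (p.dropUntil a ha)
  have h3 := congrArg Walk.length (p.take_spec ha)
  rw [Walk.length_append] at h3
  omega

/-- Distance in a tree is convex along a geodesic starting with the edge `ac`. -/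
lemma mul_dist_le_of_geodesic {T : SimpleGraph V} (hT : T.IsTree) {a b c : V} {D : ℕ}
    (hac : T.Adj a c) (hab : T.dist a b = D + 1) (hcb : T.dist c b = D) (x : V) :
    (D + 1) * T.dist x c ≤ D * T.dist x a + T.dist x b := by
  have hne := hT.dist_ne_of_adj x hac
  have h1 : T.dist a c = 1 := dist_eq_one_iff_adj.2 hac
  have h2 := hT.connected.dist_triangle (u := x) (v := a) (w := c)
  have h3 := hT.connected.dist_triangle (u := x) (v := b) (w := a)
  have h4 : T.dist b a = D + 1 := by rw [dist_comm, hab]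
  have h5 : T.dist b c = D := by rw [dist_comm, hcb]
  rcases lt_or_gt_of_ne hne with h | h
  · have := dist_add_dist_le_of_dist_lt hT hac h (y := b) (by omega)
    have e : T.dist x c = T.dist x a + 1 := by omega
    rw [e]; nlinarith
  · have : T.dist x c + 1 ≤ T.dist x a := h
    nlinarith [Nat.mul_le_mul_left D this]

/-- Distinct weight centers of a tree are adjacent. -/
lemma adj_of_mem_weightCenters [Fintype V] {T : SimpleGraph V} (hT : T.IsTree) {a b : V}
    (ha : a ∈ weightCenters T) (hb : b ∈ weightCenters T) (hab : a ≠ b) : T.Adj a b := by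
  by_contra hadj
  have h1 := hT.connected.one_lt_dist_of_ne_of_not_adj hab hadj
  obtain ⟨p, hp⟩ := hT.connected.exists_walk_length_eq_dist a b
  cases p with
  | nil => exact hab rfl
  | @cons _ c _ hac q =>
    rw [Walk.length_cons] at hp
    have h2 := dist_le q
    have h3 := hT.connected.dist_triangle (u := a) (v := c) (w := b)
    have h4 : T.dist a c = 1 := dist_eq_one_iff_adj.2 hac
    obtain ⟨D, hD⟩ : ∃ D, T.dist c b = D := ⟨_, rfl⟩
    have hcv := mul_dist_le_of_geodesic hT hac (by omega) hD
    have hlt : ∑ x, (D + 1) * T.dist x c < ∑ x, (D * T.dist x a + T.dist x b) := by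
      refine Finset.sum_lt_sum (fun x _ => hcv x) ⟨c, Finset.mem_univ _, ?_⟩
      rw [dist_self, hD]
      omega
    rw [Finset.sum_add_distrib, ← Finset.mul_sum, ← Finset.mul_sum] at hlt
    have hw : ∀ u, ∑ x, T.dist x u = weight T u := fun u =>
      Finset.sum_congr rfl fun x _ => dist_comm
    rw [hw, hw, hw] at hlt
    have := hb a
    nlinarith [Nat.mul_le_mul_left D (ha c)]

lemma exists_mem_weightCenters_dist_eq_level [Fintype V] [Nonempty V] (T : SimpleGraph V)
    (x : V) : ∃ w ∈ weightCenters T, T.dist x w = level T x := by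
  obtain ⟨w, hw⟩ := Finite.exists_min (weight T)
  exact Nat.sInf_mem
    (s := {d : ℕ | ∃ w ∈ weightCenters T, T.dist x w = d}) ⟨_, w, hw, rfl⟩

lemma level_le_dist [Fintype V] {T : SimpleGraph V} {w : V} (hw : w ∈ weightCenters T) (x : V) :
    level T x ≤ T.dist x w :=
  Nat.sInf_le ⟨w, hw, rfl⟩

lemma eps_le_one [Fintype V] (T : SimpleGraph V) : eps T ≤ 1 := by
  unfold eps; split_ifs <;> simp

/-- The distance in a tree is at most the sum of the levels, plus one when there are two weight
centers. -/
lemma dist_add_eps_le [Fintype V] {T : SimpleGraph V} (hT : T.IsTree) (x y : V) :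
    T.dist x y + eps T ≤ level T x + level T y + 1 := by
  have : Nonempty V := ⟨x⟩
  obtain ⟨a, ha, hxa⟩ := exists_mem_weightCenters_dist_eq_level T x
  obtain ⟨b, hb, hyb⟩ := exists_mem_weightCenters_dist_eq_level T y
  have h1 := hT.connected.dist_triangle (u := x) (v := a) (w := y)
  have h2 := hT.connected.dist_triangle (u := a) (v := b) (w := y)
  rw [dist_comm (u := b)] at h2
  by_cases hab : a = b
  · subst hab
    have := eps_le_one T
    simp only [dist_self] at h2
    omega
  · have h3 := dist_eq_one_iff_adj.2 (adj_of_mem_weightCenters hT ha hb hab)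
    have h4 : eps T = 0 := by
      unfold eps
      rw [if_neg]
      intro h
      obtain ⟨w, hw⟩ := Set.ncard_eq_one.1 h
      rw [hw] at ha hb
      exact hab (ha.trans hb.symm)
    omega

lemma differentBranches_of_dist_eq [Fintype V] {T : SimpleGraph V}
    (h : (weightCenters T).ncard = 1) {x y : V}
    (hxy : T.dist x y + eps T = level T x + level T y + 1) : DifferentBranches T x y := by
  have : Nonempty V := ⟨x⟩
  obtain ⟨a, ha, hxa⟩ := exists_mem_weightCenters_dist_eq_level T x
  obtain ⟨b, hb, hyb⟩ := exists_mem_weightCenters_dist_eq_level T y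
  obtain ⟨w, hw⟩ := Set.ncard_eq_one.1 h
  have hab : b = a := by
    rw [hw] at ha hb
    exact hb.trans ha.symm
  subst hab
  have h1 : eps T = 1 := if_pos h
  refine ⟨b, hb, ?_⟩
  rw [dist_comm (u := b)]
  omega

lemma oppositeBranches_of_dist_eq [Fintype V] {T : SimpleGraph V} (hT : T.IsTree)
    (h : (weightCenters T).ncard = 2) {x y : V}
    (hxy : T.dist x y + eps T = level T x + level T y + 1) : OppositeBranches T x y := by
  have : Nonempty V := ⟨x⟩
  obtain ⟨a, ha, hxa⟩ := exists_mem_weightCenters_dist_eq_level T x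
  obtain ⟨b, hb, hyb⟩ := exists_mem_weightCenters_dist_eq_level T y
  have h0 : eps T = 0 := if_neg (by omega)
  have h1 := hT.connected.dist_triangle (u := x) (v := a) (w := y)
  have h2 := hT.connected.dist_triangle (u := x) (v := b) (w := y)
  rw [dist_comm (u := a)] at h1
  rw [dist_comm (u := b)] at h2
  have hab : a ≠ b := by
    rintro rfl
    omega
  have hW : weightCenters T = {a, b} := by
    refine (Set.eq_of_subset_of_ncard_le ?_ ?_).symm
    · rintro z (rfl | rfl)
      exacts [ha, hb]
    · rw [Set.ncard_pair hab, h]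
  exact ⟨a, b, hab, hW, not_reachable_deleteEdges_of_dist_lt hT
    (adj_of_mem_weightCenters hT ha hb hab) (by omega) (by omega)⟩

lemma dist_boxProd {W : Type*} {G : SimpleGraph V} {H : SimpleGraph W} (hG : G.Connected)
    (hH : H.Connected) (p q : V × W) :
    (G.boxProd H).dist p q = G.dist p.1 q.1 + H.dist p.2 q.2 := by
  have h := edist_boxProd (G := G) (H := H) p q
  rw [← ((hG.boxProd hH) p q).coe_dist_eq_edist, ← (hG p.1 q.1).coe_dist_eq_edist,
    ← (hH p.2 q.2).coe_dist_eq_edist] at h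
  exact_mod_cast h

lemma dist_le_graphDiam [Fintype V] (G : SimpleGraph V) (u v : V) : G.dist u v ≤ graphDiam G :=
  Finset.le_sup (f := fun p : V × V => G.dist p.1 p.2) (Finset.mem_univ (u, v))

lemma exists_dist_eq_graphDiam [Fintype V] [Nonempty V] (G : SimpleGraph V) :
    ∃ u v : V, G.dist u v = graphDiam G := by
  obtain ⟨p, -, hp⟩ := Finset.exists_mem_eq_sup (Finset.univ : Finset (V × V))
    Finset.univ_nonempty fun p => G.dist p.1 p.2
  exact ⟨p.1, p.2, hp.symm⟩

lemma graphDiam_add_le_boxProd {W : Type*} [Fintype V] [Fintype W] {G : SimpleGraph V}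
    {H : SimpleGraph W} (hG : G.Connected) (hH : H.Connected) :
    graphDiam G + graphDiam H ≤ graphDiam (G.boxProd H) := by
  have := hG.nonempty
  have := hH.nonempty
  obtain ⟨a, b, hab⟩ := exists_dist_eq_graphDiam G
  obtain ⟨c, d, hcd⟩ := exists_dist_eq_graphDiam H
  have := dist_le_graphDiam (G.boxProd H) (a, c) (b, d)
  rw [dist_boxProd hG hH] at this
  simpa only [hab, hcd] using this

end Distance

lemma genPetersen_connected (m k : ℕ) [NeZero m] : (genPetersen m k).Connected := by
  have hspoke : ∀ i : ZMod m, (genPetersen m k).Reachable (false, i) (true, i) := fun i =>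
    SimpleGraph.Adj.reachable (by simp [genPetersen])
  have hrim : ∀ i : ZMod m, (genPetersen m k).Reachable (false, i) (false, i + 1) := by
    intro i
    by_cases h : i + 1 = i
    · rw [h]
    · refine SimpleGraph.Adj.reachable ?_
      simp [genPetersen, Ne.symm h]
  have hzero : ∀ i : ℕ, (genPetersen m k).Reachable (false, 0) (false, (i : ZMod m)) := by
    intro i
    induction i with
    | zero => simp
    | succ i ih =>
      rw [Nat.cast_succ]
      exact ih.trans (hrim i)
  have hall : ∀ v, (genPetersen m k).Reachable (false, 0) v := by
    rintro ⟨b, i⟩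
    have hi := hzero i.val
    rw [ZMod.natCast_zmod_val] at hi
    cases b
    · exact hi
    · exact hi.trans (hspoke i)
  exact ⟨fun u v => (hall u).symm.trans (hall v)⟩

/-- The radio number is attained by some radio labeling. -/
lemma exists_isRadioLabeling_radioSpan_eq [Fintype V] (G : SimpleGraph V) :
    ∃ f : V → ℕ, IsRadioLabeling G f ∧ radioSpan f = radioNumber G := by
  refine Nat.sInf_mem
    (s := {s : ℕ | ∃ f : V → ℕ, IsRadioLabeling G f ∧ radioSpan f = s}) ?_
  let e := Fintype.equivFin V
  refine ⟨_, fun v => (graphDiam G + 1) * (e v : ℕ), fun u v huv => ?_, rfl⟩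
  have hne : ((e u : ℕ) : ℤ) - (e v : ℕ) ≠ 0 := by
    intro h
    exact huv (e.injective (Fin.ext (by omega)))
  have h1 : (1 : ℤ) ≤ |((e u : ℕ) : ℤ) - (e v : ℕ)| := Int.one_le_abs hne
  push_cast
  rw [← mul_sub, abs_mul, abs_of_nonneg (by positivity)]
  nlinarith

lemma IsRadioLabeling.injective [Fintype V] {G : SimpleGraph V} {f : V → ℕ}
    (hf : IsRadioLabeling G f) : Function.Injective f := by
  intro u v huv
  by_contra hne
  have h1 := hf u v hne
  have h2 := dist_le_graphDiam G u v
  simp only [huv, sub_self, abs_zero] at h1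
  omega

/-- The elements of a nonempty finite type can be listed in increasing order of an injective
function. -/
lemma exists_strictly_increasing_ordering [Fintype V] [Nonempty V] {f : V → ℕ}
    (hf : Function.Injective f) {N : ℕ} (hN : Fintype.card V = N) :
    ∃ o : ℕ → V, (∀ v, ∃! t, t < N ∧ o t = v) ∧
      (∀ s t, s < t → t < N → f (o s) < f (o t)) ∧
      ∀ g : V → ℤ, ∑ t ∈ Finset.range N, g (o t) = ∑ v, g v := by
  let e : Fin N ≃ V := (Fintype.equivFinOfCardEq hN).symm
  let r : Fin N ≃ V := (Tuple.sort (f ∘ e)).trans e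
  have hmono : StrictMono (f ∘ r) :=
    (Tuple.monotone_sort (f ∘ e)).strictMono_of_injective (hf.comp r.injective)
  refine ⟨fun t => if h : t < N then r ⟨t, h⟩ else Classical.arbitrary V, fun v => ?_,
    fun s t hst ht => ?_, fun g => ?_⟩
  · refine ⟨(r.symm v : ℕ), ⟨(r.symm v).2, by simp⟩, ?_⟩
    rintro t ⟨ht, rfl⟩
    simp [ht]
  · simp only [ht, hst.trans ht, dif_pos]
    exact hmono (Fin.mk_lt_mk.2 hst)
  · rw [Finset.sum_range, ← r.sum_comp]
    simp

/-- If a sequence grows at each step by at least `K - l t - l (t + 1)` and its total growth is at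
most `M K - 2 ∑ l`, then all these inequalities are equalities and the endpoint terms vanish. -/
lemma eq_of_growth_le {a l : ℕ → ℤ} {K : ℤ} {M : ℕ}
    (hstep : ∀ t < M, a t + K - l t - l (t + 1) ≤ a (t + 1)) (h0 : 0 ≤ l 0) (hM : 0 ≤ l M)
    (htot : a M - a 0 ≤ M * K - 2 * ∑ t ∈ Finset.range (M + 1), l t) :
    l 0 + l M = 0 ∧ ∀ t < M, a (t + 1) = a t + K - l t - l (t + 1) := by
  have hnn : ∀ t ∈ Finset.range M, 0 ≤ (a (t + 1) - a t) - K + l t + l (t + 1) := by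
    intro t ht
    have := hstep t (Finset.mem_range.1 ht)
    linarith
  have hsum : ∑ t ∈ Finset.range M, ((a (t + 1) - a t) - K + l t + l (t + 1)) + (l 0 + l M) =
      a M - a 0 - M * K + 2 * ∑ t ∈ Finset.range (M + 1), l t := by
    have h1 := Finset.sum_range_succ l M
    have h2 := Finset.sum_range_succ' l M
    simp only [Finset.sum_add_distrib, Finset.sum_sub_distrib, Finset.sum_const,
      Finset.card_range, nsmul_eq_mul]
    rw [← Finset.sum_sub_distrib, Finset.sum_range_sub]
    linarith
  have hpos := Finset.sum_nonneg hnn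
  have hzero : ∑ t ∈ Finset.range M, ((a (t + 1) - a t) - K + l t + l (t + 1)) = 0 := by linarith
  refine ⟨by linarith, fun t ht => ?_⟩
  have := (Finset.sum_eq_zero_iff_of_nonneg hnn).1 hzero t (Finset.mem_range.2 ht)
  linarith

/-- Necessity in Theorem 3.1: if the radio number of `P_{m,k} □ T` attains the lower bound
`(2mn - 1)(d_t + ε) - 4m·L(T)`, then there is an ordering `z_0, …, z_{2mn-1}` of the
vertices, `z_t = (x_{i_t}, y_{j_t})`, satisfying (a) consecutive Petersen coordinates at
distance `d_p`; (b) `L_T(y_{j_0}) + L_T(y_{j_{2mn-1}}) = 0`; (c) consecutive tree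
coordinates in different branches (one weight center) resp. opposite branches (two weight
centers); and (d) the mapping `f` defined by `f(z_0) = 0` and
`f(z_{t+1}) = f(z_t) + d_t + ε - L_T(y_{j_t}) - L_T(y_{j_{t+1}})` is a radio labeling. -/
theorem exists_ordering_of_radioNumber_eq_lower_bound
    {Vt : Type*} [Fintype Vt] (m k n : ℕ) [NeZero m] (hm : 3 ≤ m) (hk : 1 ≤ k)
    (T : SimpleGraph Vt) (hT : T.IsTree) (hn : Fintype.card Vt = n)
    (h : (radioNumber ((genPetersen m k).boxProd T) : ℤ) =
      ((2 * m * n : ℤ) - 1) * ((graphDiam T : ℤ) + eps T) - 4 * m * totalLevel T) :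
    ∃ o : ℕ → (Bool × ZMod m) × Vt,
      (∀ v : (Bool × ZMod m) × Vt, ∃! t : ℕ, t < 2 * m * n ∧ o t = v) ∧
      (∀ t : ℕ, t + 1 < 2 * m * n →
        (genPetersen m k).dist (o t).1 (o (t + 1)).1 = graphDiam (genPetersen m k)) ∧
      level T (o 0).2 + level T (o (2 * m * n - 1)).2 = 0 ∧
      (∀ t : ℕ, t + 1 < 2 * m * n →
        ((weightCenters T).ncard = 1 → DifferentBranches T (o t).2 (o (t + 1)).2) ∧
        ((weightCenters T).ncard = 2 → OppositeBranches T (o t).2 (o (t + 1)).2)) ∧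
      (∃ f : (Bool × ZMod m) × Vt → ℕ,
        f (o 0) = 0 ∧
        (∀ t : ℕ, t + 1 < 2 * m * n →
          (f (o (t + 1)) : ℤ) = (f (o t) : ℤ) + graphDiam T + eps T -
            level T (o t).2 - level T (o (t + 1)).2) ∧
        IsRadioLabeling ((genPetersen m k).boxProd T) f) := by
  classical
  have hP := genPetersen_connected m k
  have hC := hT.connected
  have := hC.nonempty
  obtain ⟨f, hf, hspan⟩ := exists_isRadioLabeling_radioSpan_eq ((genPetersen m k).boxProd T)
  have hcard : Fintype.card ((Bool × ZMod m) × Vt) = 2 * m * n := by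
    simp [ZMod.card, hn]
  obtain ⟨o, hbij, hinc, hsum⟩ := exists_strictly_increasing_ordering hf.injective hcard
  obtain ⟨M, hM⟩ : ∃ M, 2 * m * n = M + 1 :=
    Nat.exists_eq_succ_of_ne_zero (by rw [← hcard]; exact Fintype.card_ne_zero)
  have hMZ : (2 * m * n : ℤ) = M + 1 := by exact_mod_cast hM
  rw [hM] at hbij hinc hsum ⊢
  have hlevel : ∑ t ∈ Finset.range (M + 1), (level T (o t).2 : ℤ) = 2 * m * totalLevel T := by
    rw [hsum fun v => (level T v.2 : ℤ), Fintype.sum_prod_type]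
    simp [ZMod.card, totalLevel]
  have hdiam := graphDiam_add_le_boxProd hP hC
  have hgap : ∀ t < M, (graphDiam (genPetersen m k) : ℤ) + graphDiam T + 1 -
      (genPetersen m k).dist (o t).1 (o (t + 1)).1 - T.dist (o t).2 (o (t + 1)).2 ≤
      (f (o (t + 1)) : ℤ) - f (o t) := by
    intro t ht
    have hlt := hinc t (t + 1) (by omega) (by omega)
    have h1 := hf (o (t + 1)) (o t) (fun he => by rw [he] at hlt; omega)
    rw [abs_of_nonneg (by omega), SimpleGraph.dist_comm, dist_boxProd hP hC] at h1
    push_cast at h1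
    omega
  have hpd : ∀ t, (genPetersen m k).dist (o t).1 (o (t + 1)).1 ≤ graphDiam (genPetersen m k) :=
    fun t => dist_le_graphDiam _ _ _
  have htd : ∀ t, T.dist (o t).2 (o (t + 1)).2 + eps T ≤
      level T (o t).2 + level T (o (t + 1)).2 + 1 := fun t => dist_add_eps_le hT _ _
  have hspan_le : f (o M) - f (o 0) ≤ radioSpan f :=
    Finset.le_sup (f := fun p : ((Bool × ZMod m) × Vt) × ((Bool × ZMod m) × Vt) => f p.1 - f p.2)
      (Finset.mem_univ (o M, o 0))
  obtain ⟨hends, hstep⟩ := eq_of_growth_le (a := fun t => (f (o t) : ℤ))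
    (l := fun t => (level T (o t).2 : ℤ)) (K := graphDiam T + eps T) (M := M)
    (fun t ht => by have := hgap t ht; have := hpd t; have := htd t; omega)
    (by positivity) (by positivity)
    (by
      rw [hlevel]
      rw [← hspan, hMZ] at h
      have : (f (o M) : ℤ) - f (o 0) ≤ radioSpan f := by omega
      linarith)
  have hmin : ∀ v, f (o 0) ≤ f v := by
    intro v
    obtain ⟨t, ⟨ht, rfl⟩, -⟩ := hbij v
    rcases Nat.eq_zero_or_pos t with rfl | h0
    · exact le_rfl
    · exact (hinc 0 t h0 ht).le
  refine ⟨o, hbij, fun t ht => ?_, by rw [Nat.add_sub_cancel]; omega, fun t ht => ?_,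
    fun v => f v - f (o 0), Nat.sub_self _, fun t ht => ?_, fun u v huv => ?_⟩
  · have := hgap t (by omega)
    have := hstep t (by omega)
    have := hpd t
    have := htd t
    omega
  · have hd : T.dist (o t).2 (o (t + 1)).2 + eps T =
        level T (o t).2 + level T (o (t + 1)).2 + 1 := by
      have := hgap t (by omega)
      have := hstep t (by omega)
      have := hpd t
      have := htd t
      omega
    exact ⟨fun h1 => differentBranches_of_dist_eq h1 hd,
      fun h2 => oppositeBranches_of_dist_eq hT h2 hd⟩
  · have := hstep t (by omega)
    have := hmin (o t)
    have := hmin (o (t + 1))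
    push_cast [Nat.cast_sub (hmin (o t)), Nat.cast_sub (hmin (o (t + 1)))]
    linarith
  · rw [Nat.cast_sub (hmin u), Nat.cast_sub (hmin v), sub_sub_sub_cancel_right]
    exact hf u v huv

end RadioPaper
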